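/- Let F be a strongly convex Minkowski norm on ℝ^m which is of class C³ on ℝ^m ∖ {0}, with fundamental tensor g, Legendre map ℓ, and dual co-Finsler norm F^*. For ω ≠ 0 define the fundamental tensor of F^* by g^*_ω(η₁,η₂) := (1/2)·D²(F^{*2})(ω)[η₁,η₂], a bilinear form on (ℝ^m)^*. Then for every v ≠ 0 and all u, w ∈ ℝ^m one has g^*_{ℓ(v)}( g_v(u,·), g_v(w,·) ) = g_v(u, w); equivalently, in any linear coordinates, the matrix of g^*_{ℓ(v)} is the inverse of the matrix of g_v. -/

import Mathlib

open scoped Topology Classical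
open MeasureTheory
noncomputable section

/-- One half of the second Fréchet derivative of `F²` at `v`, evaluated on `(w₁, w₂)`:
the fundamental tensor of `F`. -/
def fundTensor {V : Type*} [NormedAddCommGroup V] [NormedSpace ℝ V]
    (F : V → ℝ) (v w₁ w₂ : V) : ℝ :=
  (1 / 2) * fderiv ℝ (fderiv ℝ (fun u => (F u) ^ 2)) v w₁ w₂

/-- A strongly convex Minkowski norm on a real normed space. -/
structure IsMinkowskiNorm {V : Type*} [NormedAddCommGroup V] [NormedSpace ℝ V]
    (F : V → ℝ) : Prop where
  continuous : Continuous F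
  map_zero : F 0 = 0
  pos : ∀ v : V, v ≠ 0 → 0 < F v
  homog : ∀ lam : ℝ, 0 < lam → ∀ v : V, F (lam • v) = lam * F v
  smooth : ContDiffOn ℝ 2 F {0}ᶜ
  symm : ∀ v : V, v ≠ 0 → ∀ w₁ w₂ : V, fundTensor F v w₁ w₂ = fundTensor F v w₂ w₁
  posdef : ∀ v : V, v ≠ 0 → ∀ w : V, w ≠ 0 → 0 < fundTensor F v w w

/-- The Legendre map of `F`: `ℓ(v) = (1/2) D(F²)(v)` for `v ≠ 0`, and `ℓ(0) = 0`. -/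
def legendre {V : Type*} [NormedAddCommGroup V] [NormedSpace ℝ V]
    (F : V → ℝ) (v : V) : V →L[ℝ] ℝ :=
  if v = 0 then 0 else (1 / 2 : ℝ) • fderiv ℝ (fun u => (F u) ^ 2) v

/-- The dual co-Finsler norm `F^*(ω) = sup {ω v : F v = 1}`. -/
def dualNorm {V : Type*} [NormedAddCommGroup V] [NormedSpace ℝ V]
    (F : V → ℝ) (ω : V →L[ℝ] ℝ) : ℝ :=
  sSup ((fun v => ω v) '' {v | F v = 1})

lemma HasFDerivAt.continuousLinearMap_comp {E U W : Type*}
    [NormedAddCommGroup E] [NormedSpace ℝ E] [NormedAddCommGroup U] [NormedSpace ℝ U]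
    [NormedAddCommGroup W] [NormedSpace ℝ W] {f : E → U} {f' : E →L[ℝ] U} {x : E}
    (hf : HasFDerivAt f f' x) (T : U →L[ℝ] W) :
    HasFDerivAt (fun y => T (f y)) (T.comp f') x :=
  T.hasFDerivAt.comp x hf

section MinkowskiNorm

variable {V : Type*} [NormedAddCommGroup V] [NormedSpace ℝ V] {F : V → ℝ}

/-- One half of the derivative of `D(F²)`: the linear map `u ↦ g_v(u, ·)`. -/
def fundTensorMap (F : V → ℝ) (v : V) : V →L[ℝ] V →L[ℝ] ℝ :=
  (1 / 2 : ℝ) • fderiv ℝ (fderiv ℝ (fun x => (F x) ^ 2)) v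

lemma fundTensorMap_apply (F : V → ℝ) (v u w : V) :
    fundTensorMap F v u w = fundTensor F v u w := by
  simp [fundTensorMap, fundTensor]

namespace IsMinkowskiNorm

lemma contDiffAt_sq (hF : IsMinkowskiNorm F) {x : V} (hx : x ≠ 0) :
    ContDiffAt ℝ 2 (fun u => (F u) ^ 2) x :=
  (hF.smooth.contDiffAt (isOpen_compl_singleton.mem_nhds hx)).pow 2

lemma hasFDerivAt_sq (hF : IsMinkowskiNorm F) {x : V} (hx : x ≠ 0) :
    HasFDerivAt (fun u => (F u) ^ 2) ((2 : ℝ) • legendre F x) x := by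
  have h := ((hF.contDiffAt_sq hx).differentiableAt (by norm_num)).hasFDerivAt
  simpa [legendre, hx, smul_smul] using h

lemma hasStrictFDerivAt_legendre (hF : IsMinkowskiNorm F) {x : V} (hx : x ≠ 0) :
    HasStrictFDerivAt (legendre F) (fundTensorMap F x) x := by
  have h1 : ContDiffAt ℝ 1 (fderiv ℝ (fun u => (F u) ^ 2)) x :=
    (hF.contDiffAt_sq hx).fderiv_right (by norm_num)
  have h2 := (h1.hasStrictFDerivAt (by norm_num)).const_smul (1 / 2 : ℝ)
  refine h2.congr_of_eventuallyEq ?_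
  filter_upwards [isOpen_compl_singleton.mem_nhds hx] with y hy
  have hy' : y ≠ 0 := hy
  simp [legendre, hy']

lemma legendre_smul (hF : IsMinkowskiNorm F) {c : ℝ} (hc : 0 < c) (x : V) :
    legendre F (c • x) = c • legendre F x := by
  by_cases hx : x = 0
  · simp [hx, legendre]
  have hcx : c • x ≠ 0 := smul_ne_zero hc.ne' hx
  have hc' : HasFDerivAt (fun u : V => c • u) (c • ContinuousLinearMap.id ℝ V) x :=
    (hasFDerivAt_id x).const_smul c
  have h1 := (hF.hasFDerivAt_sq hcx).comp x hc'
  have h2 := (hF.hasFDerivAt_sq hx).const_smul (c ^ 2)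
  have he : (fun u => (F u) ^ 2) ∘ (fun u => c • u) = c ^ 2 • fun u => (F u) ^ 2 := by
    ext y
    simp [hF.homog c hc, mul_pow]
  rw [he] at h1
  ext w
  have h3 := congrArg (fun T : V →L[ℝ] ℝ => T w) (h1.unique h2)
  simp at h3 ⊢
  apply mul_left_cancel₀ hc.ne'
  linarith

lemma legendre_apply_self (hF : IsMinkowskiNorm F) {x : V} (hx : x ≠ 0) :
    legendre F x x = (F x) ^ 2 := by
  have hl : HasDerivAt (fun t : ℝ => t • x) x 1 := by
    simpa using (hasDerivAt_id (1 : ℝ)).smul_const x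
  have h1 : HasDerivAt (fun t : ℝ => (F (t • x)) ^ 2) (2 * legendre F x x) 1 := by
    have h : HasFDerivAt (fun u => (F u) ^ 2) ((2 : ℝ) • legendre F x) ((1 : ℝ) • x) := by
      simpa using hF.hasFDerivAt_sq hx
    exact h.comp_hasDerivAt (1 : ℝ) hl
  have h2 : HasDerivAt (fun t : ℝ => t ^ 2 * (F x) ^ 2) (2 * (F x) ^ 2) 1 := by
    simpa using (hasDerivAt_pow 2 (1 : ℝ)).mul_const ((F x) ^ 2)
  have he : (fun t : ℝ => (F (t • x)) ^ 2) =ᶠ[𝓝 1] fun t => t ^ 2 * (F x) ^ 2 := by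
    filter_upwards [lt_mem_nhds (zero_lt_one' ℝ)] with t ht
    rw [hF.homog t ht, mul_pow]
  linarith [h1.unique (h2.congr_of_eventuallyEq he)]

lemma fundTensorMap_apply_self (hF : IsMinkowskiNorm F) {x : V} (hx : x ≠ 0) :
    fundTensorMap F x x = legendre F x := by
  have hl : HasDerivAt (fun t : ℝ => t • x) x 1 := by
    simpa using (hasDerivAt_id (1 : ℝ)).smul_const x
  have h1 : HasDerivAt (fun t : ℝ => legendre F (t • x)) (fundTensorMap F x x) 1 := by
    have h : HasFDerivAt (legendre F) (fundTensorMap F x) ((1 : ℝ) • x) := by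
      simpa using (hF.hasStrictFDerivAt_legendre hx).hasFDerivAt
    exact h.comp_hasDerivAt (1 : ℝ) hl
  have h2 : HasDerivAt (fun t : ℝ => t • legendre F x) (legendre F x) 1 := by
    simpa using (hasDerivAt_id (1 : ℝ)).smul_const (legendre F x)
  have he : (fun t : ℝ => legendre F (t • x)) =ᶠ[𝓝 1] fun t => t • legendre F x := by
    filter_upwards [lt_mem_nhds (zero_lt_one' ℝ)] with t ht
    exact hF.legendre_smul ht x
  exact h1.unique (h2.congr_of_eventuallyEq he)

/-- Convexity of `F²` along a segment avoiding the origin. -/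
lemma two_mul_legendre_le_of_segment (hF : IsMinkowskiNorm F) {x y : V}
    (h : ∀ t ∈ Set.Icc (0 : ℝ) 1, x + t • (y - x) ≠ 0) :
    2 * legendre F x y ≤ (F x) ^ 2 + (F y) ^ 2 := by
  have hl (t : ℝ) : HasDerivAt (fun t : ℝ => x + t • (y - x)) (y - x) t := by
    simpa using ((hasDerivAt_id t).smul_const (y - x)).const_add x
  have h1 (t : ℝ) (ht : t ∈ Set.Icc (0 : ℝ) 1) :
      HasDerivAt (fun t : ℝ => (F (x + t • (y - x))) ^ 2)
        (2 * legendre F (x + t • (y - x)) (y - x)) t := by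
    simpa [Function.comp_def] using (hF.hasFDerivAt_sq (h t ht)).comp_hasDerivAt t (hl t)
  have h2 (t : ℝ) (ht : t ∈ Set.Icc (0 : ℝ) 1) :
      HasDerivAt (fun t : ℝ => legendre F (x + t • (y - x)) (y - x))
        (fundTensorMap F (x + t • (y - x)) (y - x) (y - x)) t := by
    have := ((hF.hasStrictFDerivAt_legendre (h t ht)).hasFDerivAt.comp_hasDerivAt t (hl t))
    simpa using this.clm_apply (hasDerivAt_const t (y - x))
  obtain ⟨c, hc, hc'⟩ := exists_hasDerivAt_eq_slope _ _ (zero_lt_one' ℝ)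
    (fun t ht => (h1 t ht).continuousAt.continuousWithinAt)
    (fun t ht => h1 t (Set.Ioo_subset_Icc_self ht))
  have hsub : Set.Icc 0 c ⊆ Set.Icc (0 : ℝ) 1 := Set.Icc_subset_Icc_right hc.2.le
  obtain ⟨d, hd, hd'⟩ := exists_hasDerivAt_eq_slope _ _ hc.1
    (fun t ht => (h2 t (hsub ht)).continuousAt.continuousWithinAt)
    (fun t ht => h2 t (hsub (Set.Ioo_subset_Icc_self ht)))
  have hpos : 0 ≤ fundTensorMap F (x + d • (y - x)) (y - x) (y - x) := by
    rw [fundTensorMap_apply]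
    by_cases hxy : y - x = 0
    · simp [hxy, fundTensor]
    · exact (hF.posdef _ (h d (hsub (Set.Ioo_subset_Icc_self hd))) _ hxy).le
  rw [hd', sub_zero, le_div_iff₀ hc.1] at hpos
  have hx0 : x ≠ 0 := by simpa using h 0 (by simp)
  have hxx := hF.legendre_apply_self hx0
  simp at hc' hpos
  linarith

/-- The fundamental inequality, for `y` on the indicatrix. -/
lemma legendre_apply_le (hF : IsMinkowskiNorm F) {x y : V} (hx : x ≠ 0) (hy : F y = 1) :
    legendre F x y ≤ F x := by
  have hFx := hF.pos x hx
  by_cases h : ∀ t ∈ Set.Icc (0 : ℝ) 1, (F x)⁻¹ • x + t • (y - (F x)⁻¹ • x) ≠ 0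
  · have h1 := hF.two_mul_legendre_le_of_segment h
    rw [hF.legendre_smul (inv_pos.2 hFx), hF.homog _ (inv_pos.2 hFx), hy,
      inv_mul_cancel₀ hFx.ne'] at h1
    have h2 : (F x)⁻¹ * legendre F x y ≤ 1 := by
      simp at h1
      linarith
    rwa [inv_mul_le_iff₀ hFx, mul_one] at h2
  · push Not at h
    obtain ⟨t, ht, h⟩ := h
    have h1 := congrArg (legendre F x) h
    simp [hF.legendre_apply_self hx] at h1
    have h2 : (F x)⁻¹ * F x ^ 2 = F x := by field_simp
    rw [h2] at h1
    have ht0 : t ≠ 0 := by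
      rintro rfl
      simp at h1
      linarith
    have ht1 : 0 < t := lt_of_le_of_ne ht.1 ht0.symm
    by_contra! hlt
    nlinarith [mul_pos ht1 (hFx.trans hlt), mul_lt_mul_of_pos_left hlt ht1, ht.2]

lemma dualNorm_legendre (hF : IsMinkowskiNorm F) {x : V} (hx : x ≠ 0) :
    dualNorm F (legendre F x) = F x := by
  have hFx := hF.pos x hx
  refine IsGreatest.csSup_eq ⟨⟨(F x)⁻¹ • x, ?_, ?_⟩, ?_⟩
  · simp [hF.homog _ (inv_pos.2 hFx), hFx.ne']
  · simp only [map_smul, hF.legendre_apply_self hx, smul_eq_mul]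
    field_simp
  · rintro _ ⟨y, hy, rfl⟩
    exact hF.legendre_apply_le hx hy

lemma fundTensorMap_symm (hF : IsMinkowskiNorm F) {x : V} (hx : x ≠ 0) (u w : V) :
    fundTensorMap F x u w = fundTensorMap F x w u := by
  simp only [fundTensorMap_apply, hF.symm x hx u w]

variable [FiniteDimensional ℝ V]

lemma exists_equiv_eq_fundTensorMap (hF : IsMinkowskiNorm F) {x : V} (hx : x ≠ 0) :
    ∃ e : V ≃L[ℝ] (V →L[ℝ] ℝ), (e : V →L[ℝ] V →L[ℝ] ℝ) = fundTensorMap F x := by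
  have hinj : Function.Injective (fundTensorMap F x).toLinearMap := by
    rw [← LinearMap.ker_eq_bot, LinearMap.ker_eq_bot']
    intro w hw
    by_contra hw0
    have h := hF.posdef x hx w hw0
    rw [← fundTensorMap_apply] at h
    have hw' : fundTensorMap F x w = 0 := hw
    simp [hw'] at h
  have hdim : Module.finrank ℝ V = Module.finrank ℝ (V →L[ℝ] ℝ) := by
    rw [← (LinearMap.toContinuousLinearMap (𝕜 := ℝ) (E := V) (F' := ℝ)).finrank_eq]
    exact (Subspace.dual_finrank_eq (K := ℝ) (V := V)).symm
  refine ⟨(LinearMap.linearEquivOfInjective _ hinj hdim).toContinuousLinearEquiv, ?_⟩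
  ext u w
  simp

/-- `D(F^{*2})(ω) = 2 ev_{ℓ⁻¹(ω)}`, for any local inverse of the Legendre map. -/
lemma hasFDerivAt_dualNorm_sq (hF : IsMinkowskiNorm F)
    (K : OpenPartialHomeomorph V (V →L[ℝ] ℝ)) (hK : (K : V → V →L[ℝ] ℝ) = legendre F)
    {ω : V →L[ℝ] ℝ} (hω : ω ∈ K.target) (h0 : K.symm ω ≠ 0) :
    HasFDerivAt (fun η => (dualNorm F η) ^ 2)
      ((2 : ℝ) • ContinuousLinearMap.apply ℝ ℝ (K.symm ω)) ω := by
  have hinv {η : V →L[ℝ] ℝ} (hη : η ∈ K.target) : legendre F (K.symm η) = η := by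
    rw [← hK, K.right_inv hη]
  obtain ⟨e, he⟩ := hF.exists_equiv_eq_fundTensorMap h0
  have hd : HasFDerivAt K.symm (e.symm : (V →L[ℝ] ℝ) →L[ℝ] V) ω := by
    refine K.hasFDerivAt_symm hω ?_
    rw [hK, he]
    exact (hF.hasStrictFDerivAt_legendre h0).hasFDerivAt
  have h1 := (hF.hasFDerivAt_sq h0).comp ω hd
  have heq : (fun η => (dualNorm F η) ^ 2) =ᶠ[𝓝 ω] (fun u => (F u) ^ 2) ∘ K.symm := by
    filter_upwards [K.open_target.mem_nhds hω,
      (K.continuousAt_symm hω).eventually_ne h0] with η hη hη0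
    have := hF.dualNorm_legendre hη0
    rw [hinv hη] at this
    simp [this]
  refine (h1.congr_of_eventuallyEq heq).congr_fderiv ?_
  ext η
  have hη : fundTensorMap F (K.symm ω) (e.symm η) = η := by
    rw [← he]
    simp
  have h2 : legendre F (K.symm ω) (e.symm η) = η (K.symm ω) := by
    rw [← hF.fundTensorMap_apply_self h0, hF.fundTensorMap_symm h0, hη]
  simp [h2]

/-- The fundamental tensor of the dual norm at `ℓ(v)` is the inverse of that of `F` at `v`. -/
lemma fundTensor_dualNorm (hF : IsMinkowskiNorm F) {v : V} (hv : v ≠ 0) (u w : V) :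
    fundTensor (dualNorm F) (legendre F v) (fundTensorMap F v u) (fundTensorMap F v w) =
      fundTensor F v u w := by
  have : CompleteSpace V := FiniteDimensional.complete ℝ V
  obtain ⟨e, he⟩ := hF.exists_equiv_eq_fundTensorMap hv
  have hs := hF.hasStrictFDerivAt_legendre hv
  rw [← he] at hs
  set K := hs.toOpenPartialHomeomorph (legendre F)
  have hK : (K : V → V →L[ℝ] ℝ) = legendre F := hs.toOpenPartialHomeomorph_coe
  have hmem : legendre F v ∈ K.target := hs.image_mem_toOpenPartialHomeomorph_target
  have hKv : K.symm (legendre F v) = v := by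
    rw [← hK]
    exact K.left_inv hs.mem_toOpenPartialHomeomorph_source
  have hd : HasFDerivAt K.symm (e.symm : (V →L[ℝ] ℝ) →L[ℝ] V) (legendre F v) := by
    refine K.hasFDerivAt_symm hmem ?_
    rw [hK, hKv]
    exact hs.hasFDerivAt
  have heq : fderiv ℝ (fun η => (dualNorm F η) ^ 2) =ᶠ[𝓝 (legendre F v)]
      fun η => (2 : ℝ) • ContinuousLinearMap.apply ℝ ℝ (K.symm η) := by
    filter_upwards [K.open_target.mem_nhds hmem,
      (K.continuousAt_symm hmem).eventually_ne (by rwa [hKv])] with η hη hη0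
    exact (hF.hasFDerivAt_dualNorm_sq K hK hη hη0).fderiv
  let T : V →L[ℝ] (V →L[ℝ] ℝ) →L[ℝ] ℝ := (2 : ℝ) • ContinuousLinearMap.apply ℝ ℝ
  have h1 : HasFDerivAt (fun η => T (K.symm η))
      (T.comp (e.symm : (V →L[ℝ] ℝ) →L[ℝ] V)) (legendre F v) :=
    hd.continuousLinearMap_comp (W := (V →L[ℝ] ℝ) →L[ℝ] ℝ) T
  have h2 := h1.congr_of_eventuallyEq heq
  have hu : e.symm (fundTensorMap F v u) = u := by
    rw [← he]
    simp
  rw [fundTensor, h2.fderiv, ← fundTensorMap_apply, hF.fundTensorMap_symm hv u w]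
  simp [hu, T]

end IsMinkowskiNorm

end MinkowskiNorm

/-- the fundamental tensor of `F^*` at `ℓ(v)` is the inverse of the
fundamental tensor of `F` at `v`:
`g^*_{ℓ(v)}(g_v(u,·), g_v(w,·)) = g_v(u, w)` for all `v ≠ 0` and `u, w`. -/
theorem dual_fundTensor_inverse
    {m : ℕ} (hm : 2 ≤ m) (F : EuclideanSpace ℝ (Fin m) → ℝ)
    (hF : IsMinkowskiNorm F)
    (hsm : ContDiffOn ℝ 3 F ({0}ᶜ : Set (EuclideanSpace ℝ (Fin m)))) :
    ∀ v : EuclideanSpace ℝ (Fin m), v ≠ 0 → ∀ u w : EuclideanSpace ℝ (Fin m),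
      fundTensor (dualNorm F) (legendre F v)
        ((1 / 2 : ℝ) • fderiv ℝ (fderiv ℝ (fun x => (F x) ^ 2)) v u)
        ((1 / 2 : ℝ) • fderiv ℝ (fderiv ℝ (fun x => (F x) ^ 2)) v w)
      = fundTensor F v u w := by
  intro v hv u w
  exact hF.fundTensor_dualNorm hv u w
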